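/- Let f : E(G*) → E(S10) be an S10-coloring of G* such that the edges of the circuit H' = H[f^{-1}(A1) ∩ E1] are alternately mapped to the two parallel edges joining x1 and y1 in S10, and let f_V : V(G*) → V(S10) be the induced vertex mapping (f_V(v) is the vertex u of S10 with f(∂_{G*}(v)) = ∂_{S10}(u)). Then f_V(u) ∈ {z1, w}, where u is the vertex of G* arising from the subdivided vertex of the Petersen graph. -/

import Mathlib

/-- A loopless multigraph: each edge has an unordered pair of distinct endpoints.
Parallel edges are allowed. -/
structure Multigraph (V : Type) (E : Type) where
  ends : E → Sym2 V
  loopless : ∀ e, ¬ (ends e).IsDiag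

namespace Multigraph

variable {V E V' E' V'' E'' : Type}

/-- `G.inc v` is the set `∂_G(v)` of edges of `G` incident with the vertex `v`. -/
def inc (G : Multigraph V E) (v : V) : Set E := {e | v ∈ G.ends e}

/-- Two edges are adjacent if they are distinct and share an endpoint. -/
def EdgeAdj (G : Multigraph V E) (e₁ e₂ : E) : Prop :=
  e₁ ≠ e₂ ∧ ∃ v, e₁ ∈ G.inc v ∧ e₂ ∈ G.inc v

/-- `f` is an `H`-coloring of `G`: a proper edge-coloring (adjacent edges of `G` receive
distinct images) such that for every vertex `v` of `G` there is a vertex `u` of `H` with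
`f(∂_G(v)) = ∂_H(u)`. -/
def IsColoring (G : Multigraph V E) (H : Multigraph V' E') (f : E → E') : Prop :=
  (∀ e₁ e₂, G.EdgeAdj e₁ e₂ → f e₁ ≠ f e₂) ∧
  (∀ v : V, ∃ u : V', f '' G.inc v = H.inc u)

end Multigraph

/-- The Sylvester graph `S₁₀`: vertex `0` is the centre `w`; vertices `1,2,3` are
`z₁,z₂,z₃`; vertices `4,5` are `x₁,y₁`; vertices `6,7` are `x₂,y₂`; vertices `8,9` are
`x₃,y₃`.  Edges `9,…,14` are the three pairs of parallel edges. -/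
def S10 : Multigraph (Fin 10) (Fin 15) where
  ends := ![s(0,1), s(0,2), s(0,3), s(1,4), s(1,5), s(2,6), s(2,7), s(3,8), s(3,9),
            s(4,5), s(4,5), s(6,7), s(6,7), s(8,9), s(8,9)]
  loopless := by decide

/-- `A₁` is the set of the six edges of `S₁₀` lying in a pair of parallel edges. -/
def A1 : Set (Fin 15) := {9, 10, 11, 12, 13, 14}

/-- The graph `G*`.  Vertices `0,…,8` induce the Petersen graph minus a vertex `v₀`
(vertices `0`, `3`, `4` are the former neighbours of `v₀`); vertex `9` is `u`;
vertices `10`, `11` are `s₁`, `s₂`; vertices `12,13,14` form the triangle `t₁t₂t₃`;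
vertices `15,…,23` are the three attached copies of `S₄` (with `17`, `20`, `23`
the vertices `c` joined to `s₁`, `s₂`, `t₃` respectively).
Edges `0,…,11` form `E₁` (the copy of the Petersen graph minus a vertex),
edges `12,…,23` form `E₂`, and edges `24,…,35` are the edges of the copies of `S₄`. -/
def Gstar : Multigraph (Fin 24) (Fin 36) where
  ends := ![s(0,1), s(1,2), s(2,3), s(0,5), s(1,6), s(2,7), s(3,8), s(4,6), s(4,7),
            s(5,7), s(5,8), s(6,8),
            s(9,10), s(9,11), s(9,12), s(12,13), s(13,14), s(12,14),
            s(10,0), s(11,3), s(13,4), s(10,17), s(11,20), s(14,23),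
            s(15,16), s(15,16), s(15,17), s(16,17),
            s(18,19), s(18,19), s(18,20), s(19,20),
            s(21,22), s(21,22), s(21,23), s(22,23)]
  loopless := by decide

/-- `E₁`: the edges of the subgraph `H` of `G*` isomorphic to the Petersen graph minus
a vertex. -/
def E1 : Set (Fin 36) := {e | e.val ≤ 11}

/-- `E₂`: the edges of `G*` belonging neither to `E₁` nor to a copy of `S₄`. -/
def E2 : Set (Fin 36) := {e | 12 ≤ e.val ∧ e.val ≤ 23}

/-- The colors `a`, `b`, `c` are the three distinct edges of `S₁₀` at some vertex. -/
def IsStar (a b c : Fin 15) : Prop :=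
  ∃ u, u ∈ S10.ends a ∧ u ∈ S10.ends b ∧ u ∈ S10.ends c ∧ a ≠ b ∧ a ≠ c ∧ b ≠ c

/-- The pairs completing a color to the star of one of `w, z₁, z₂, z₃, x₁, y₁`. -/
def starCompletions : Fin 15 → List (Fin 15 × Fin 15)
  | 0 => [(1, 2), (2, 1), (3, 4), (4, 3)]
  | 1 => [(0, 2), (2, 0), (5, 6), (6, 5)]
  | 2 => [(0, 1), (1, 0), (7, 8), (8, 7)]
  | 3 => [(0, 4), (4, 0), (9, 10), (10, 9)]
  | 4 => [(0, 3), (3, 0), (9, 10), (10, 9)]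
  | 5 => [(1, 6), (6, 1)]
  | 6 => [(1, 5), (5, 1)]
  | 7 => [(2, 8), (8, 2)]
  | 8 => [(2, 7), (7, 2)]
  | 9 => [(3, 10), (10, 3), (4, 10), (10, 4)]
  | 10 => [(3, 9), (9, 3), (4, 9), (9, 4)]
  | _ => []

theorem IsStar.mem_starCompletions {a b c : Fin 15} (h : IsStar a b c) (hb : b ≤ 10)
    (hac : a ≤ 10 ∨ c ≤ 10) : (b, c) ∈ starCompletions a := by
  have key : ∀ u a, u ∈ S10.ends a → ∀ b, u ∈ S10.ends b → a ≠ b → b ≤ 10 →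
      ∀ c, u ∈ S10.ends c → a ≠ c → b ≠ c → (a ≤ 10 ∨ c ≤ 10) →
      (b, c) ∈ starCompletions a := by
    decide +kernel
  obtain ⟨u, ha, hb', hc, hab, hac', hbc⟩ := h
  exact key u a ha b hb' hab hb c hc hac' hbc hac

/-- A coloring of the Petersen graph minus a vertex by the stars of `w, z₁, z₂, z₃, x₁, y₁`
does not use the colors `5, 6, 7, 8` on a dangling edge. -/
theorem dangling_color_not_mem_Icc {a e₀ e₁ e₂ e₃ e₄ e₅ e₆ e₇ e₈ e₉ e₁₀ e₁₁ b c : Fin 15}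
    (h₀ : (e₀, e₃) ∈ starCompletions a) (h₁ : (e₁, e₄) ∈ starCompletions e₀)
    (h₅ : (e₉, e₁₀) ∈ starCompletions e₃) (h₂ : (e₂, e₅) ∈ starCompletions e₁)
    (h₇ : (e₅, e₈) ∈ starCompletions e₉) (h₆ : (e₇, e₁₁) ∈ starCompletions e₄)
    (h₈ : (e₁₁, e₆) ∈ starCompletions e₁₀) (h₃ : (e₆, b) ∈ starCompletions e₂)
    (h₄ : (e₈, c) ∈ starCompletions e₇) : a ∉ Finset.Icc 5 8 := by
  have key : [(5 : Fin 15), 6, 7, 8].all fun a => (starCompletions a).all fun p =>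
      (starCompletions p.1).all fun q => (starCompletions p.2).all fun r =>
      (starCompletions q.1).all fun s => (starCompletions r.1).all fun t =>
      t.1 != s.2 || (starCompletions q.2).all fun v => (starCompletions r.2).all fun w =>
      w.1 != v.2 || (starCompletions s.1).all fun x => x.1 != w.2 ||
      (starCompletions v.1).all fun y => y.1 != t.2 := by
    decide +kernel
  simp only [List.all_eq_true, Bool.or_eq_true, bne_iff_ne, ← imp_iff_not_or] at key
  intro ha
  have mem : ∀ a ∈ Finset.Icc (5 : Fin 15) 8, a ∈ [(5 : Fin 15), 6, 7, 8] := by decide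
  exact key a (mem a ha) _ h₀ _ h₁ _ h₅ _ h₂ _ h₇ rfl _ h₆ _ h₈ rfl _ h₃ rfl _ h₄ rfl

/-- The pendant edge of a copy of `S₄` is mapped to a bridge of `S₁₀`. -/
theorem IsStar.bridge_le_two {p q r r' b : Fin 15} (h : IsStar p q r) (h' : IsStar p q r')
    (hb : IsStar r r' b) : b ≤ 2 := by
  have key : ∀ u p, u ∈ S10.ends p → ∀ q, u ∈ S10.ends q → p ≠ q →
      ∀ r, u ∈ S10.ends r → p ≠ r → q ≠ r →
      ∀ u', u' ∈ S10.ends p → u' ∈ S10.ends q →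
      ∀ r', u' ∈ S10.ends r' → p ≠ r' → q ≠ r' → r ≠ r' →
      ∀ u'', u'' ∈ S10.ends r → u'' ∈ S10.ends r' →
      ∀ b, u'' ∈ S10.ends b → r ≠ b → r' ≠ b → b ≤ 2 := by
    decide +kernel
  obtain ⟨u, hp, hq, hr, hpq, hpr, hqr⟩ := h
  obtain ⟨u', hp', hq', hr', -, hpr', hqr'⟩ := h'
  obtain ⟨u'', hr₁, hr₂, hb, hrr, hrb, hrb'⟩ := hb
  exact key u p hp q hq hpq r hr hpr hqr u' hp' hq' r' hr' hpr' hqr' hrr u'' hr₁ hr₂ b hb hrb hrb'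

theorem IsStar.le_four {a d b : Fin 15} (h : IsStar a d b) (hb : b ≤ 2)
    (hd : d ∉ Finset.Icc 5 8) : a ≤ 4 := by
  have key : ∀ u b, b ≤ 2 → u ∈ S10.ends b → ∀ d ∉ Finset.Icc (5 : Fin 15) 8, u ∈ S10.ends d →
      ∀ a, u ∈ S10.ends a → a ≠ d → a ≠ b → d ≠ b → a ≤ 4 := by
    decide +kernel
  obtain ⟨u, ha, hd', hb', had, hab, hdb⟩ := h
  exact key u b hb hb' d hd hd' a ha had hab hdb

theorem eq_one_or_zero_of_le_four {u : Fin 10} {a b : Fin 15} (ha : u ∈ S10.ends a)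
    (hb : u ∈ S10.ends b) (hab : a ≠ b) (ha4 : a ≤ 4) (hb4 : b ≤ 4) : u = 1 ∨ u = 0 := by
  revert u a b
  decide +kernel

/-- Let `f` be an `S₁₀`-coloring of `G*` whose circuit `H' = H[f⁻¹(A₁) ∩ E₁]` has all
its edges mapped (alternately) to the two parallel edges `9`, `10` joining `x₁ = 4` and
`y₁ = 5` in `S₁₀`, and let `f_V` be the induced vertex mapping.  Then the vertex
`u = 9` of `G*` (arising from the subdivided vertex of the Petersen graph) satisfies
`f_V(u) ∈ {z₁, w} = {1, 0}`. -/
theorem fV_of_u_in_z1_w (f : Fin 36 → Fin 15) (hf : Gstar.IsColoring S10 f)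
    (halt : ∀ e ∈ (f ⁻¹' A1) ∩ E1, f e = 9 ∨ f e = 10)
    (fV : Fin 24 → Fin 10) (hfV : ∀ v, f '' Gstar.inc v = S10.inc (fV v)) :
    fV 9 = 1 ∨ fV 9 = 0 := by
  have mem (v : Fin 24) (e : Fin 36) (h : v ∈ Gstar.ends e) : fV v ∈ S10.ends (f e) := by
    have : f e ∈ S10.inc (fV v) := hfV v ▸ Set.mem_image_of_mem f h
    exact this
  have ne (v : Fin 24) (e e' : Fin 36) (h : v ∈ Gstar.ends e) (h' : v ∈ Gstar.ends e')
      (hne : e ≠ e') : f e ≠ f e' :=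
    hf.1 e e' ⟨hne, v, h, h'⟩
  have star (v : Fin 24) (i j k : Fin 36)
      (h : v ∈ Gstar.ends i ∧ v ∈ Gstar.ends j ∧ v ∈ Gstar.ends k ∧ i ≠ j ∧ i ≠ k ∧ j ≠ k) :
      IsStar (f i) (f j) (f k) := by
    obtain ⟨hi, hj, hk, hij, hik, hjk⟩ := h
    exact ⟨fV v, mem v i hi, mem v j hj, mem v k hk, ne v i j hi hj hij, ne v i k hi hk hik,
      ne v j k hj hk hjk⟩
  have le_ten (e : Fin 36) (he : e.val ≤ 11) : f e ≤ 10 := by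
    by_contra hlt
    have hA : f e ∈ A1 := by
      have : ∀ c : Fin 15, ¬ c ≤ 10 → c = 9 ∨ c = 10 ∨ c = 11 ∨ c = 12 ∨ c = 13 ∨ c = 14 := by
        decide
      simpa [A1] using this _ hlt
    rcases halt e ⟨hA, he⟩ with h | h <;> exact hlt (h.trans_le (by decide))
  have completion (v : Fin 24) (i j k : Fin 36)
      (h : v ∈ Gstar.ends i ∧ v ∈ Gstar.ends j ∧ v ∈ Gstar.ends k ∧ i ≠ j ∧ i ≠ k ∧ j ≠ k)
      (hj : j.val ≤ 11) (hik : i.val ≤ 11 ∨ k.val ≤ 11) :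
      (f j, f k) ∈ starCompletions (f i) :=
    (star v i j k h).mem_starCompletions (le_ten j hj) (hik.imp (le_ten i) (le_ten k))
  have h18 : f 18 ∉ Finset.Icc 5 8 :=
    dangling_color_not_mem_Icc
      (completion 0 18 0 3 (by decide) (by decide) (by decide))
      (completion 1 0 1 4 (by decide) (by decide) (by decide))
      (completion 5 3 9 10 (by decide) (by decide) (by decide))
      (completion 2 1 2 5 (by decide) (by decide) (by decide))
      (completion 7 9 5 8 (by decide) (by decide) (by decide))
      (completion 6 4 7 11 (by decide) (by decide) (by decide))
      (completion 8 10 11 6 (by decide) (by decide) (by decide))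
      (completion 3 2 6 19 (by decide) (by decide) (by decide))
      (completion 4 7 8 20 (by decide) (by decide) (by decide))
  have h19 : f 19 ∉ Finset.Icc 5 8 :=
    dangling_color_not_mem_Icc
      (completion 3 19 2 6 (by decide) (by decide) (by decide))
      (completion 2 2 1 5 (by decide) (by decide) (by decide))
      (completion 8 6 11 10 (by decide) (by decide) (by decide))
      (completion 1 1 0 4 (by decide) (by decide) (by decide))
      (completion 6 11 4 7 (by decide) (by decide) (by decide))
      (completion 7 5 8 9 (by decide) (by decide) (by decide))
      (completion 5 10 9 3 (by decide) (by decide) (by decide))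
      (completion 0 0 3 18 (by decide) (by decide) (by decide))
      (completion 4 8 7 20 (by decide) (by decide) (by decide))
  have h21 : f 21 ≤ 2 :=
    (star 15 24 25 26 (by decide)).bridge_le_two (star 16 24 25 27 (by decide))
      (star 17 26 27 21 (by decide))
  have h22 : f 22 ≤ 2 :=
    (star 18 28 29 30 (by decide)).bridge_le_two (star 19 28 29 31 (by decide))
      (star 20 30 31 22 (by decide))
  exact eq_one_or_zero_of_le_four (mem 9 12 (by decide)) (mem 9 13 (by decide))
    (ne 9 12 13 (by decide) (by decide) (by decide))
    ((star 10 12 18 21 (by decide)).le_four h21 h18)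
    ((star 11 13 19 22 (by decide)).le_four h22 h19)
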